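/- arXiv:1511.02982 — 2 statements merged into one kernel-verified Lean document; each statement's English description precedes it below -/
import Mathlib

section
/- Let J ⊆ A(𝔹_d) be a closed ideal and let K = Z(J) ∩ 𝕊_d. For a complex regular Borel measure μ on 𝕊_d, let Φ_μ ∈ A(𝔹_d)* denote the bounded linear functional φ ↦ ∫_{𝕊_d} φ dμ. If the set {Φ_μ : μ an A(𝔹_d)-totally singular complex regular Borel measure concentrated on K} is closed in the weak-* topology of the dual space A(𝔹_d)*, then K is A(𝔹_d)-totally null. -/
open MeasureTheory Metric Set Filter Topology

noncomputable section

abbrev CB (d : ℕ) : Set (EuclideanSpace ℂ (Fin d)) := Metric.closedBall 0 1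

instance (d : ℕ) : CompactSpace (CB d) :=
  isCompact_iff_compactSpace.mp (isCompact_closedBall _ _)

instance (d : ℕ) : MeasurableSpace (EuclideanSpace ℂ (Fin d)) := borel _

instance (d : ℕ) : BorelSpace (EuclideanSpace ℂ (Fin d)) := ⟨rfl⟩

def polyAlg (d : ℕ) : Subalgebra ℂ C(CB d, ℂ) :=
  Algebra.adjoin ℂ
    { f : C(CB d, ℂ) | ∃ i : Fin d,
        f = ⟨fun z => (z : EuclideanSpace ℂ (Fin d)) i,
             (EuclideanSpace.proj (𝕜 := ℂ) i).continuous.comp continuous_subtype_val⟩ }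

def ballAlgSub (d : ℕ) : Subalgebra ℂ C(CB d, ℂ) := (polyAlg d).topologicalClosure

def ballAlg (d : ℕ) : Set C(CB d, ℂ) := ballAlgSub d

def sphereD (d : ℕ) : Set (CB d) := {z | ‖(z : EuclideanSpace ℂ (Fin d))‖ = 1}

def openD (d : ℕ) : Set (CB d) := {z | ‖(z : EuclideanSpace ℂ (Fin d))‖ < 1}

def ZS (d : ℕ) (S : Set C(CB d, ℂ)) : Set (CB d) := {z | ∀ φ ∈ S, φ z = 0}

def IX (d : ℕ) (X : Set (CB d)) : Set C(CB d, ℂ) :=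
  {φ | φ ∈ ballAlg d ∧ ∀ z ∈ X, φ z = 0}

def IsZeroSet (d : ℕ) (X : Set (CB d)) : Prop :=
  ∃ S ⊆ ballAlg d, X = ZS d S

/-- A representing measure for a point of the closed ball: a finite positive regular
Borel measure integrating every function of the ball algebra to its value at the point. -/
def IsRepMeasure (d : ℕ) (lam : CB d) (μ : Measure (CB d)) : Prop :=
  IsFiniteMeasure μ ∧ μ.Regular ∧ ∀ φ ∈ ballAlg d, φ lam = ∫ z, φ z ∂μ

/-- `X̂₀` : `X₀` together with all points of the open ball having a representing measure
supported on `X₀`. -/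
def hatSet (d : ℕ) (X0 : Set (CB d)) : Set (CB d) :=
  X0 ∪ {lam | lam ∈ openD d ∧
    ∃ μ : Measure (CB d), IsRepMeasure d lam μ ∧ μ X0ᶜ = 0}

/-- `z` is an isolated point of the set `A`. -/
def IsIsolatedIn (d : ℕ) (A : Set (CB d)) (z : CB d) : Prop :=
  z ∈ A ∧ ∃ U : Set (CB d), IsOpen U ∧ U ∩ A = {z}

/-- A closed ideal of the ball algebra. -/
structure IsClosedIdeal (d : ℕ) (J : Set C(CB d, ℂ)) : Prop where
  subset : J ⊆ ballAlg d
  closed : IsClosed J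
  zero_mem : (0 : C(CB d, ℂ)) ∈ J
  add_mem : ∀ f ∈ J, ∀ g ∈ J, f + g ∈ J
  smul_mem : ∀ (c : ℂ), ∀ f ∈ J, c • f ∈ J
  mul_mem : ∀ f ∈ ballAlg d, ∀ g ∈ J, f * g ∈ J

/-- An `A(𝔹_d)`-Henkin (finite positive regular Borel) measure on the sphere. -/
def IsHenkin (d : ℕ) (μ : Measure (CB d)) : Prop :=
  IsFiniteMeasure μ ∧ μ.Regular ∧ μ (sphereD d)ᶜ = 0 ∧
    ∀ f : ℕ → C(CB d, ℂ), (∀ n, f n ∈ ballAlg d) → (∃ C : ℝ, ∀ n, ‖f n‖ ≤ C) →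
      (∀ z ∈ openD d, Tendsto (fun n => f n z) atTop (𝓝 0)) →
      Tendsto (fun n => ∫ z, f n z ∂μ) atTop (𝓝 0)

/-- An `A(𝔹_d)`-totally null subset of the sphere. -/
def IsTotallyNull (d : ℕ) (K : Set (CB d)) : Prop :=
  K ⊆ sphereD d ∧ ∀ μ : Measure (CB d), IsHenkin d μ → μ K = 0

/-- A complex regular Borel measure on the sphere, given by its polar decomposition:
total variation `var` (a finite positive regular Borel measure concentrated on the
sphere) and a unimodular density. -/
structure CMeasure (d : ℕ) where
  var : Measure (CB d)
  density : CB d → ℂ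
  finite : IsFiniteMeasure var
  regular : var.Regular
  measurable_density : Measurable density
  norm_density : ∀ z, ‖density z‖ = 1
  onSphere : var (sphereD d)ᶜ = 0

/-- Integral of a continuous function against a complex measure. -/
def cInt (d : ℕ) (μ : CMeasure d) (φ : C(CB d, ℂ)) : ℂ :=
  ∫ z, φ z * μ.density z ∂μ.var

/-- An `A(𝔹_d)`-Henkin complex measure on the sphere. -/
def IsHenkinC (d : ℕ) (μ : CMeasure d) : Prop :=
  ∀ f : ℕ → C(CB d, ℂ), (∀ n, f n ∈ ballAlg d) → (∃ C : ℝ, ∀ n, ‖f n‖ ≤ C) →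
    (∀ z ∈ openD d, Tendsto (fun n => f n z) atTop (𝓝 0)) →
    Tendsto (fun n => cInt d μ (f n)) atTop (𝓝 0)

/-- An `A(𝔹_d)`-totally singular complex measure: its total variation is mutually
singular with that of every Henkin complex measure. -/
def IsTotallySingularC (d : ℕ) (μ : CMeasure d) : Prop :=
  ∀ ν : CMeasure d, IsHenkinC d ν → μ.var ⟂ₘ ν.var

/-- An `A(𝔹_d)`-totally null Borel subset of the sphere (complex-measure version). -/
def IsTotallyNullC (d : ℕ) (K : Set (CB d)) : Prop :=
  K ⊆ sphereD d ∧ ∀ μ : CMeasure d, IsHenkinC d μ → μ.var K = 0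


section CMeasureLemmas

variable {d : ℕ}

theorem isClosed_sphereD (d : ℕ) : IsClosed (sphereD d) :=
  isClosed_eq continuous_subtype_val.norm continuous_const

theorem isClosed_ZS (d : ℕ) (S : Set C(CB d, ℂ)) : IsClosed (ZS d S) := by
  have : ZS d S = ⋂ φ ∈ S, {z | φ z = 0} := by ext; simp [ZS]
  rw [this]
  exact isClosed_biInter fun φ _ => isClosed_eq φ.continuous continuous_const

theorem integrable_continuousMap (m : Measure (CB d)) [IsFiniteMeasure m] (φ : C(CB d, ℂ)) :
    Integrable (fun z => φ z) m :=
  Integrable.of_bound φ.continuous.aestronglyMeasurable ‖φ‖ (ae_of_all _ φ.norm_coe_le_norm)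

/-- The polar decomposition of the complex measure with density `h` against `m`. -/
theorem exists_cMeasure_of_density (m : Measure (CB d)) (hm : m (sphereD d)ᶜ = 0)
    {h : CB d → ℂ} (hh : Measurable h) (hi : Integrable h m) :
    ∃ μ : CMeasure d, μ.var = m.withDensity (fun z => ‖h z‖ₑ) ∧
      ∀ φ : C(CB d, ℂ), cInt d μ φ = ∫ z, φ z * h z ∂m := by
  classical
  have hfin : IsFiniteMeasure (m.withDensity fun z => ‖h z‖ₑ) :=
    isFiniteMeasure_withDensity hi.hasFiniteIntegral.ne
  have hzero : MeasurableSet {z | h z = 0} := hh (measurableSet_singleton 0)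
  refine ⟨⟨m.withDensity fun z => ‖h z‖ₑ, fun z => if h z = 0 then 1 else h z / ‖h z‖, hfin,
    inferInstance, Measurable.ite hzero measurable_const
      (hh.div (Complex.measurable_ofReal.comp hh.norm)), fun z => ?_,
    withDensity_absolutelyContinuous _ _ hm⟩, rfl, fun φ => ?_⟩
  · split_ifs with hz
    · simp
    · simp [hz]
  · have := integral_withDensity_eq_integral_smul (μ := m) hh.nnnorm
      (fun z => φ z * if h z = 0 then 1 else h z / ‖h z‖)
    refine this.trans (integral_congr_ae (ae_of_all _ fun z => ?_))
    by_cases hz : h z = 0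
    · simp [hz]
    · have hz' : (‖h z‖ : ℂ) ≠ 0 := by simpa using hz
      simp only [hz, if_false, NNReal.smul_def, coe_nnnorm, Complex.real_smul]
      field_simp

theorem isHenkinC_of_annihilates {μ : CMeasure d} (h : ∀ φ ∈ ballAlg d, cInt d μ φ = 0) :
    IsHenkinC d μ := fun f hf _ _ => by
  simp only [h _ (hf _)]
  exact tendsto_const_nhds

/-- The function `z ↦ (1 + ⟨z, ζ⟩) / 2` of the ball algebra peaks exactly at `ζ`. -/
theorem exists_peak_function {ζ : CB d} (hζ : ζ ∈ sphereD d) :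
    ∃ p ∈ ballAlg d, p ζ = 1 ∧ ∀ z, z ≠ ζ → ‖p z‖ < 1 := by
  let coord (i : Fin d) : C(CB d, ℂ) := ⟨fun z => (z : EuclideanSpace ℂ (Fin d)) i,
    (EuclideanSpace.proj (𝕜 := ℂ) i).continuous.comp continuous_subtype_val⟩
  have hcoord (i : Fin d) : coord i ∈ polyAlg d := Algebra.subset_adjoin ⟨i, rfl⟩
  let p : C(CB d, ℂ) :=
    (2⁻¹ : ℂ) • (1 + ∑ i, (starRingEnd ℂ ((ζ : EuclideanSpace ℂ (Fin d)) i)) • coord i)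
  have hp (z : CB d) : p z = 2⁻¹ * (1 + inner ℂ (ζ : EuclideanSpace ℂ (Fin d)) z) := by
    have h (i : Fin d) : coord i z = (z : EuclideanSpace ℂ (Fin d)) i := rfl
    simp only [p, ContinuousMap.smul_apply, ContinuousMap.add_apply, ContinuousMap.one_apply,
      ContinuousMap.sum_apply, PiLp.inner_apply, RCLike.inner_apply, smul_eq_mul, h, mul_comm]
  have hζ1 : ‖(ζ : EuclideanSpace ℂ (Fin d))‖ = 1 := hζ
  refine ⟨p, ?_, ?_, fun z hz => ?_⟩
  · refine (polyAlg d).le_topologicalClosure ?_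
    exact Subalgebra.smul_mem _ (add_mem (one_mem _)
      (sum_mem fun i _ => Subalgebra.smul_mem _ (hcoord i) _)) _
  · rw [hp, inner_self_eq_norm_sq_to_K, hζ1]
    norm_num
  · have hz1 : ‖(z : EuclideanSpace ℂ (Fin d))‖ ≤ 1 := mem_closedBall_zero_iff.1 z.2
    set w : ℂ := inner ℂ (ζ : EuclideanSpace ℂ (Fin d)) z with hw
    have hw1 : ‖w‖ ≤ 1 := by
      refine (norm_inner_le_norm _ _).trans ?_
      rwa [hζ1, one_mul]
    have hre : w.re < 1 := by
      have hne : (0 : ℝ) < ‖(ζ : EuclideanSpace ℂ (Fin d)) - z‖ :=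
        norm_pos_iff.2 (sub_ne_zero.2 fun h => hz (Subtype.ext h.symm))
      have hsq := norm_sub_sq (𝕜 := ℂ) (ζ : EuclideanSpace ℂ (Fin d)) z
      rw [← hw, hζ1] at hsq
      simp only [RCLike.re_eq_complex_re] at hsq
      nlinarith [norm_nonneg (z : EuclideanSpace ℂ (Fin d))]
    have hsq : ‖1 + w‖ ^ 2 = 1 + 2 * w.re + ‖w‖ ^ 2 := by
      rw [Complex.sq_norm, Complex.sq_norm, Complex.normSq_apply, Complex.normSq_apply]
      simp
      ring
    have hlt : ‖1 + w‖ < 2 := by nlinarith [norm_nonneg w, norm_nonneg (1 + w)]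
    rw [hp, norm_mul, norm_inv]
    norm_num
    linarith

theorem IsHenkinC.var_singleton {ν : CMeasure d} (hν : IsHenkinC d ν) {ζ : CB d}
    (hζ : ζ ∈ sphereD d) : ν.var {ζ} = 0 := by
  have := ν.finite
  obtain ⟨p, hpA, hpζ, hp⟩ := exists_peak_function hζ
  have hp1 (z : CB d) : ‖p z‖ ≤ 1 := by
    by_cases hz : z = ζ
    · simp [hz, hpζ]
    · exact (hp z hz).le
  have hpow (z : CB d) (hz : z ≠ ζ) : Tendsto (fun n => p z ^ n) atTop (𝓝 0) :=
    tendsto_pow_atTop_nhds_zero_of_norm_lt_one (hp z hz)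
  have h0 : Tendsto (fun n => cInt d ν (p ^ n)) atTop (𝓝 0) := by
    refine hν (fun n => p ^ n) (fun n => (ballAlgSub d).pow_mem hpA n)
      ⟨1, fun n => ?_⟩ fun z hz => ?_
    · refine (ContinuousMap.norm_le _ zero_le_one).2 fun z => ?_
      simpa using pow_le_one₀ (norm_nonneg _) (hp1 z)
    · have hne : z ≠ ζ := by
        rintro rfl
        exact (ne_of_lt hz) hζ
      simpa using hpow z hne
  have h1 : Tendsto (fun n => cInt d ν (p ^ n)) atTop
      (𝓝 (∫ z, ({ζ} : Set (CB d)).indicator ν.density z ∂ν.var)) := by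
    refine tendsto_integral_of_dominated_convergence (fun _ => 1) (fun n => ?_)
      (integrable_const 1) (fun n => ae_of_all _ fun z => ?_) (ae_of_all _ fun z => ?_)
    · exact ((p ^ n).continuous.measurable.mul ν.measurable_density).aestronglyMeasurable
    · simpa [ν.norm_density] using pow_le_one₀ (norm_nonneg _) (hp1 z)
    · by_cases hz : z = ζ
      · subst hz
        simp [hpζ]
      · simpa [hz] using (hpow z hz).mul_const (ν.density z)
  have h2 := tendsto_nhds_unique h1 h0
  rw [integral_indicator (measurableSet_singleton ζ), integral_singleton] at h2
  have hne : ν.density ζ ≠ 0 := norm_ne_zero_iff.1 (by simp [ν.norm_density])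
  have h3 : ν.var.real {ζ} = 0 := (smul_eq_zero.1 h2).resolve_right hne
  exact (measureReal_eq_zero_iff).1 h3

/-- The functionals on the ball algebra given by totally singular measures on `K`. -/
def singularFunctionals (d : ℕ) (K : Set (CB d)) : Set (WeakDual ℂ ↥(ballAlgSub d)) :=
  {Λ | ∃ μ : CMeasure d, IsTotallySingularC d μ ∧ μ.var (sphereD d \ K) = 0 ∧
    ∀ φ : ↥(ballAlgSub d), Λ φ = cInt d μ (φ : C(CB d, ℂ))}

/-- The evaluation functional at a point of the closed ball. -/
def evalFunctional (ζ : CB d) : WeakDual ℂ ↥(ballAlgSub d) :=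
  StrongDual.toWeakDual
    ((ContinuousMap.evalCLM ℂ ζ).comp (ballAlgSub d).toSubmodule.subtypeL)

theorem evalFunctional_apply (ζ : CB d) (φ : ↥(ballAlgSub d)) :
    evalFunctional ζ φ = (φ : C(CB d, ℂ)) ζ := rfl

theorem span_evalFunctional_subset {K : Set (CB d)} (hK : K ⊆ sphereD d) :
    (Submodule.span ℂ (evalFunctional '' K) : Set (WeakDual ℂ ↥(ballAlgSub d))) ⊆
      singularFunctionals d K := by
  intro Λ hΛ
  obtain ⟨l, hl, rfl⟩ := (Finsupp.mem_span_image_iff_linearCombination ℂ).1 hΛ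
  have hlK : ↑l.support ⊆ K := (Finsupp.mem_supported ℂ l).1 hl
  let m : Measure (CB d) := ∑ ζ ∈ l.support, Measure.dirac ζ
  have hmz (A : Set (CB d)) (hA : MeasurableSet A) (h : ∀ ζ ∈ l.support, ζ ∉ A) : m A = 0 := by
    simp only [m, Measure.finsetSum_apply]
    refine Finset.sum_eq_zero fun ζ hζ => ?_
    simp [Measure.dirac_apply' ζ hA, h ζ hζ]
  have hmeas : Measurable l := by
    have : (l : CB d → ℂ) =
        fun z => ∑ ζ ∈ l.support, ({ζ} : Set (CB d)).indicator (fun _ => l ζ) z := by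
      ext z
      classical
      simp only [Set.indicator_apply, Set.mem_singleton_iff]
      rw [Finset.sum_ite_eq l.support z]
      aesop
    rw [this]
    exact Finset.measurable_sum _ fun ζ _ =>
      measurable_const.indicator (measurableSet_singleton ζ)
  have hdirac (f : CB d → ℂ) (ζ : CB d) : Integrable f (Measure.dirac ζ) :=
    integrable_dirac (by simp)
  have hint (f : CB d → ℂ) : Integrable f m :=
    integrable_finsetSum_measure.2 fun ζ _ => hdirac f ζ
  obtain ⟨μ, hvar, hμ⟩ := exists_cMeasure_of_density m
    (hmz _ (isClosed_sphereD d).measurableSet.compl fun ζ hζ => by simpa using hK (hlK hζ))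
    hmeas (hint l)
  have hac : μ.var ≪ m := hvar ▸ withDensity_absolutelyContinuous _ _
  refine ⟨μ, fun ν hν => ?_, hac ?_, fun φ => ?_⟩
  · have hS : MeasurableSet (l.support : Set (CB d)) := l.support.measurableSet
    refine ⟨(l.support : Set (CB d))ᶜ, hS.compl, hac (hmz _ hS.compl fun ζ hζ => by simpa using hζ),
      ?_⟩
    rw [compl_compl, ← Set.biUnion_of_singleton (l.support : Set (CB d))]
    exact (measure_biUnion_null_iff l.support.countable_toSet).2
      fun ζ hζ => hν.var_singleton (hK (hlK hζ))
  · refine measure_mono_null (t := (l.support : Set (CB d))ᶜ) (fun z hz hz' => hz.2 (hlK hz'))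
      (hmz _ l.support.measurableSet.compl fun ζ hζ => by simpa using hζ)
  · rw [hμ, integral_finsetSum_measure fun ζ _ => hdirac _ ζ]
    simp only [integral_dirac]
    rw [Finsupp.linearCombination_apply, Finsupp.sum]
    refine (map_sum ((topDualPairing ℂ ↥(ballAlgSub d)).flip φ) _ _).trans
      (Finset.sum_congr rfl fun ζ _ => ?_)
    rw [mul_comm]
    rfl

/-- Integration against a finite measure, as a functional on the ball algebra. -/
def integralFunctional (m : Measure (CB d)) [IsFiniteMeasure m] : WeakDual ℂ ↥(ballAlgSub d) :=
  StrongDual.toWeakDual <| LinearMap.mkContinuous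
    { toFun := fun φ => ∫ z, (φ : C(CB d, ℂ)) z ∂m
      map_add' := fun φ ψ =>
        integral_add (integrable_continuousMap m φ.1) (integrable_continuousMap m ψ.1)
      map_smul' := fun c φ => integral_const_mul c fun z => (φ : C(CB d, ℂ)) z }
    (m.real univ) fun φ => by
      rw [mul_comm]
      exact norm_integral_le_of_norm_le_const (ae_of_all _ φ.1.norm_coe_le_norm)

theorem integralFunctional_apply (m : Measure (CB d)) [IsFiniteMeasure m] (φ : ↥(ballAlgSub d)) :
    integralFunctional m φ = ∫ z, (φ : C(CB d, ℂ)) z ∂m := rfl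

theorem exists_separating_of_notMem {E F : Type*} [AddCommGroup E] [Module ℂ E]
    [AddCommGroup F] [Module ℂ F] (B : E →ₗ[ℂ] F →ₗ[ℂ] ℂ) {W : Submodule ℂ (WeakBilin B)}
    (hW : IsClosed (W : Set (WeakBilin B))) {x : WeakBilin B} (hx : x ∉ W) :
    ∃ y : F, (∀ w ∈ W, WeakBilin.eval B y w = 0) ∧ WeakBilin.eval B y x ≠ 0 := by
  obtain ⟨f, u, hfu, hux⟩ := RCLike.geometric_hahn_banach_closed_point (𝕜 := ℂ)
    (W.restrictScalars ℝ).convex hW hx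
  obtain ⟨y, rfl⟩ := LinearMap.dualEmbedding_surjective B f
  have hu : 0 < u := by simpa using hfu 0 W.zero_mem
  refine ⟨y, fun w hw => ?_, fun h0 => ?_⟩
  · by_contra h0
    have h1 := hfu _ (W.smul_mem ((u : ℂ) / WeakBilin.eval B y w) hw)
    rw [map_smul, smul_eq_mul, div_mul_cancel₀ _ h0] at h1
    simp at h1
  · rw [h0] at hux
    simp at hux
    linarith

theorem WeakDual.exists_separating_of_notMem {E : Type*} [NormedAddCommGroup E] [NormedSpace ℂ E]
    {W : Submodule ℂ (WeakDual ℂ E)} (hW : IsClosed (W : Set (WeakDual ℂ E)))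
    {x : WeakDual ℂ E} (hx : x ∉ W) : ∃ y : E, (∀ w ∈ W, w y = 0) ∧ x y ≠ 0 :=
  _root_.exists_separating_of_notMem (E := StrongDual ℂ E) (F := E) (topDualPairing ℂ E)
    (W := W) hW (x := x) hx

theorem integralFunctional_mem_closure (m : Measure (CB d)) [IsFiniteMeasure m] {K : Set (CB d)}
    (hm : m Kᶜ = 0) :
    integralFunctional m ∈
      (Submodule.span ℂ (evalFunctional '' K)).topologicalClosure := by
  set W := (Submodule.span ℂ (evalFunctional (d := d) '' K)).topologicalClosure
  by_contra hnot
  obtain ⟨φ, hφW, hφ⟩ := WeakDual.exists_separating_of_notMem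
    (Submodule.isClosed_topologicalClosure _) hnot
  refine hφ ?_
  rw [integralFunctional_apply]
  refine integral_eq_zero_of_ae ?_
  filter_upwards [measure_eq_zero_iff_ae_notMem.1 hm] with z hz
  rw [Pi.zero_apply, ← evalFunctional_apply]
  exact hφW _ (Submodule.le_topologicalClosure _
    (Submodule.subset_span ⟨z, by simpa using hz, rfl⟩))

/-- A positive measure inducing the same functional on the ball algebra as a totally singular
measure is absolutely continuous with respect to it. -/
theorem absolutelyContinuous_of_eq_cInt (ν : Measure (CB d)) [IsFiniteMeasure ν]
    (hν : ν (sphereD d)ᶜ = 0) {σ : CMeasure d} (hσ : IsTotallySingularC d σ)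
    (h : ∀ φ ∈ ballAlg d, ∫ z, φ z ∂ν = cInt d σ φ) : ν ≪ σ.var := by
  have := σ.finite
  let m := ν + σ.var
  have : IsFiniteMeasure m := inferInstanceAs (IsFiniteMeasure (ν + σ.var))
  have : ν.HaveLebesgueDecomposition m := Measure.haveLebesgueDecomposition_of_finiteMeasure
  have : σ.var.HaveLebesgueDecomposition m := Measure.haveLebesgueDecomposition_of_finiteMeasure
  have hνm : ν ≪ m := Measure.absolutelyContinuous_of_le (Measure.le_add_right le_rfl)
  have hσm : σ.var ≪ m := Measure.absolutelyContinuous_of_le (Measure.le_add_left le_rfl)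
  let a : CB d → ℝ := fun z => (ν.rnDeriv m z).toReal
  let b : CB d → ℝ := fun z => (σ.var.rnDeriv m z).toReal
  have ha : Measurable a := (Measure.measurable_rnDeriv _ _).ennreal_toReal
  have hb : Measurable b := (Measure.measurable_rnDeriv _ _).ennreal_toReal
  have hai : Integrable a m := Measure.integrable_toReal_rnDeriv
  have hbi : Integrable b m := Measure.integrable_toReal_rnDeriv
  let k : CB d → ℂ := fun z => a z - b z * σ.density z
  have hk : Measurable k := (Complex.measurable_ofReal.comp ha).sub
    ((Complex.measurable_ofReal.comp hb).mul σ.measurable_density)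
  have hbs : Integrable (fun z => (b z : ℂ) * σ.density z) m :=
    hbi.ofReal.mul_bdd (c := 1) σ.measurable_density.aestronglyMeasurable
      (ae_of_all _ fun z => (σ.norm_density z).le)
  have hki : Integrable k m := hai.ofReal.sub hbs
  have hms : m (sphereD d)ᶜ = 0 := by simp [m, hν, σ.onSphere]
  obtain ⟨κ, hκvar, hκ⟩ := exists_cMeasure_of_density m hms hk hki
  have hκ0 : ∀ φ ∈ ballAlg d, cInt d κ φ = 0 := by
    intro φ hφ
    have hA := integral_rnDeriv_smul hνm (f := fun z => φ z)
    have hB := integral_rnDeriv_smul hσm (f := fun z => φ z * σ.density z)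
    have hφa : Integrable (fun z => φ z * (a z : ℂ)) m :=
      hai.ofReal.bdd_mul (c := ‖φ‖) φ.continuous.aestronglyMeasurable
        (ae_of_all _ φ.norm_coe_le_norm)
    have hφb : Integrable (fun z => φ z * ((b z : ℂ) * σ.density z)) m :=
      hbs.bdd_mul (c := ‖φ‖) φ.continuous.aestronglyMeasurable (ae_of_all _ φ.norm_coe_le_norm)
    rw [hκ]
    simp only [k, mul_sub]
    rw [integral_sub hφa hφb, sub_eq_zero]
    refine Eq.trans ?_ (hA.trans ((h φ hφ).trans (hB.symm.trans ?_)))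
    · exact integral_congr_ae (ae_of_all _ fun z => by simp [a, mul_comm])
    · refine integral_congr_ae (ae_of_all _ fun z => ?_)
      simp only [b, Complex.real_smul]
      ring
  obtain ⟨E, hE, hσE, hκE⟩ := hσ κ (isHenkinC_of_annihilates hκ0)
  have hbzero {A : Set (CB d)} (hA : MeasurableSet A) (h0 : σ.var A = 0) :
      ∀ᵐ z ∂m.restrict A, b z = 0 := by
    have h1 : ∫⁻ z in A, σ.var.rnDeriv m z ∂m = 0 := by
      rw [← withDensity_apply _ hA, Measure.withDensity_rnDeriv_eq _ _ hσm, h0]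
    filter_upwards [(lintegral_eq_zero_iff (Measure.measurable_rnDeriv _ _)).1 h1] with z hz
    simp [b, hz]
  have hνzero {A : Set (CB d)} (hA : MeasurableSet A) (h0 : ∀ᵐ z ∂m.restrict A, a z = 0) :
      ν A = 0 := by
    rw [← Measure.withDensity_rnDeriv_eq _ _ hνm, withDensity_apply _ hA,
      lintegral_eq_zero_iff (Measure.measurable_rnDeriv _ _)]
    filter_upwards [h0, ae_restrict_of_ae (Measure.rnDeriv_lt_top ν m)] with z hz hz'
    exact ((ENNReal.toReal_eq_zero_iff _).1 hz).resolve_right hz'.ne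
  have hkE : ∀ᵐ z ∂m.restrict Eᶜ, k z = 0 := by
    rw [hκvar, withDensity_apply _ hE.compl, lintegral_eq_zero_iff hk.enorm] at hκE
    filter_upwards [hκE] with z hz
    simpa using hz
  have hνE : ν E = 0 := by
    have h1 : ∫ z, k z ∂m = 0 := by
      simpa [hκ] using hκ0 1 (one_mem (ballAlgSub d))
    rw [← integral_add_compl hE hki, integral_eq_zero_of_ae hkE, add_zero] at h1
    have h2 : ∫ z in E, k z ∂m = ((∫ z in E, a z ∂m : ℝ) : ℂ) := by
      rw [← integral_complex_ofReal]
      refine integral_congr_ae ?_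
      filter_upwards [hbzero hE hσE] with z hz
      simp [k, hz]
    rw [h2, Complex.ofReal_eq_zero,
      integral_eq_zero_iff_of_nonneg (fun z => ENNReal.toReal_nonneg) hai.integrableOn] at h1
    exact hνzero hE h1
  refine Measure.AbsolutelyContinuous.mk fun A hA h0 => ?_
  refine measure_mono_null (t := E ∪ A ∩ Eᶜ) (fun z hz => ?_) (measure_union_null hνE ?_)
  · by_cases hzE : z ∈ E
    · exact Or.inl hzE
    · exact Or.inr ⟨hz, hzE⟩
  · refine hνzero (hA.inter hE.compl) ?_
    filter_upwards [ae_restrict_of_ae_restrict_of_subset inter_subset_left (hbzero hA h0),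
      ae_restrict_of_ae_restrict_of_subset inter_subset_right hkE] with z h1 h2
    simpa [k, h1] using h2

end CMeasureLemmas

/-- if the set of functionals given by totally singular measures
concentrated on `K = Z(J) ∩ 𝕊_d` is weak-* closed in the dual of the ball algebra,
then `K` is totally null. -/
theorem stmt15 (d : ℕ) (hd : 1 ≤ d) (J : Set C(CB d, ℂ)) (hJ : IsClosedIdeal d J)
    (hcl : IsClosed {Λ : WeakDual ℂ ↥(ballAlgSub d) |
        ∃ μ : CMeasure d, IsTotallySingularC d μ ∧
          μ.var (sphereD d \ (ZS d J ∩ sphereD d)) = 0 ∧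
          ∀ φ : ↥(ballAlgSub d), Λ φ = cInt d μ (φ : C(CB d, ℂ))}) :
    ∀ μ : CMeasure d, IsHenkinC d μ → μ.var (ZS d J ∩ sphereD d) = 0 := by
  intro μ hμ
  have := μ.finite
  set K := ZS d J ∩ sphereD d with hKdef
  have hKm : MeasurableSet K := ((isClosed_ZS d J).inter (isClosed_sphereD d)).measurableSet
  have hKs : K ⊆ sphereD d := inter_subset_right
  let ν := μ.var.restrict K
  have hνK : ν Kᶜ = 0 := by simp [ν, Measure.restrict_apply hKm.compl]
  have hmem : integralFunctional ν ∈ singularFunctionals d K :=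
    closure_minimal (span_evalFunctional_subset hKs) hcl (integralFunctional_mem_closure ν hνK)
  obtain ⟨σ, hσ, -, hσν⟩ := hmem
  have hac : ν ≪ σ.var := absolutelyContinuous_of_eq_cInt ν
    (measure_mono_null (compl_subset_compl.2 hKs) hνK) hσ fun φ hφ => hσν ⟨φ, hφ⟩
  have hν0 : ν = 0 := Measure.eq_zero_of_absolutelyContinuous_of_mutuallySingular
    Measure.absolutelyContinuous_restrict ((hσ μ hμ).mono_ac hac .rfl)
  exact Measure.restrict_eq_zero.1 hν0

end
end

section
/- Let J ⊆ A(𝔹_d) be a closed ideal and let μ be a complex regular Borel measure on 𝕊_d such that ∫_{𝕊_d} φ dμ = 0 for every φ ∈ J. Suppose μ = μ_a + μ_s, where μ_a is an A(𝔹_d)-Henkin complex measure and μ_s is an A(𝔹_d)-totally singular complex measure. Then μ_s is concentrated on Z(J) ∩ 𝕊_d, i.e., |μ_s|(𝕊_d \ Z(J)) = 0. -/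
open MeasureTheory Metric Set Filter Topology

noncomputable section

/-- The complex measure `φ • μ`, in polar form. -/
def CMeasure.mulCont {d : ℕ} (μ : CMeasure d) (φ : C(CB d, ℂ)) : CMeasure d where
  var := μ.var.withDensity fun z => ‖φ z‖ₑ
  density := fun z => if φ z = 0 then 1 else (φ z / (‖φ z‖ : ℂ)) * μ.density z
  finite := by
    have := μ.finite
    exact isFiniteMeasure_withDensity
      (φ.continuous.integrable_of_hasCompactSupport
        (HasCompactSupport.of_compactSpace _)).hasFiniteIntegral.ne
  regular := by
    have := μ.finite
    have : IsFiniteMeasure (μ.var.withDensity fun z => ‖φ z‖ₑ) := isFiniteMeasure_withDensity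
      (φ.continuous.integrable_of_hasCompactSupport
        (HasCompactSupport.of_compactSpace _)).hasFiniteIntegral.ne
    infer_instance
  measurable_density :=
    Measurable.ite (φ.continuous.measurable (measurableSet_singleton 0)) measurable_const
      ((φ.continuous.measurable.div
        (Complex.measurable_ofReal.comp φ.continuous.measurable.norm)).mul μ.measurable_density)
  norm_density z := by
    split_ifs with h
    · simp
    · simp [μ.norm_density, h]
  onSphere := withDensity_absolutelyContinuous _ _ μ.onSphere

theorem cInt_mulCont {d : ℕ} (μ : CMeasure d) (φ f : C(CB d, ℂ)) :
    cInt d (μ.mulCont φ) f = cInt d μ (f * φ) := by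
  have hφ : Measurable fun z => ‖φ z‖₊ := φ.continuous.measurable.nnnorm
  change ∫ z, _ ∂(μ.var.withDensity fun z => ((‖φ z‖₊ : NNReal) : ENNReal)) = _
  rw [integral_withDensity_eq_integral_smul hφ]
  refine integral_congr_ae (Eventually.of_forall fun z => ?_)
  simp only [CMeasure.mulCont, ContinuousMap.mul_apply, NNReal.smul_def, coe_nnnorm,
    Complex.real_smul]
  split_ifs with h
  · simp [h]
  · have h' : (‖φ z‖ : ℂ) ≠ 0 := by simpa using h
    field_simp

theorem CMeasure.integrable_density {d : ℕ} (μ : CMeasure d) : Integrable μ.density μ.var := by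
  have := μ.finite
  exact .of_bound μ.measurable_density.aestronglyMeasurable 1
    (Eventually.of_forall fun z => (μ.norm_density z).le)

theorem CMeasure.integrable_mul_density {d : ℕ} (μ : CMeasure d) (f : C(CB d, ℂ)) :
    Integrable (fun z => f z * μ.density z) μ.var :=
  μ.integrable_density.bdd_mul f.continuous.aestronglyMeasurable
    (Eventually.of_forall f.norm_coe_le_norm)

/-- Set-wise additivity of complex measures passes to integrals of continuous functions. -/
theorem cInt_eq_add {d : ℕ} {μ μ₁ μ₂ : CMeasure d}
    (h : ∀ E : Set (CB d), MeasurableSet E →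
      ∫ z in E, μ.density z ∂μ.var =
        (∫ z in E, μ₁.density z ∂μ₁.var) + ∫ z in E, μ₂.density z ∂μ₂.var)
    (f : C(CB d, ℂ)) : cInt d μ f = cInt d μ₁ f + cInt d μ₂ f := by
  have := μ.finite
  have := μ₁.finite
  have := μ₂.finite
  set ρ := μ.var + (μ₁.var + μ₂.var) with hρ
  have : IsFiniteMeasure ρ := by rw [hρ]; infer_instance
  have ac : μ.var ≪ ρ := Measure.absolutelyContinuous_of_le (Measure.le_add_right le_rfl)
  have ac₁ : μ₁.var ≪ ρ := Measure.absolutelyContinuous_of_le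
    (Measure.le_add_left (Measure.le_add_right le_rfl))
  have ac₂ : μ₂.var ≪ ρ := Measure.absolutelyContinuous_of_le
    (Measure.le_add_left (Measure.le_add_left le_rfl))
  have := Measure.haveLebesgueDecomposition_of_finiteMeasure (μ := μ.var) (ν := ρ)
  have := Measure.haveLebesgueDecomposition_of_finiteMeasure (μ := μ₁.var) (ν := ρ)
  have := Measure.haveLebesgueDecomposition_of_finiteMeasure (μ := μ₂.var) (ν := ρ)
  have int := (integrable_rnDeriv_smul_iff ac).2 μ.integrable_density
  have int₁ := (integrable_rnDeriv_smul_iff ac₁).2 μ₁.integrable_density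
  have int₂ := (integrable_rnDeriv_smul_iff ac₂).2 μ₂.integrable_density
  have key := int.ae_eq_of_forall_setIntegral_eq _ _ (int₁.add int₂) fun E hE _ => by
    simp only [Pi.add_apply]
    rw [integral_add int₁.integrableOn int₂.integrableOn, setIntegral_rnDeriv_smul ac hE,
      setIntegral_rnDeriv_smul ac₁ hE, setIntegral_rnDeriv_smul ac₂ hE, h E hE]
  unfold cInt
  rw [← integral_rnDeriv_smul ac, ← integral_rnDeriv_smul ac₁, ← integral_rnDeriv_smul ac₂,
    ← integral_add ((integrable_rnDeriv_smul_iff ac₁).2 (μ₁.integrable_mul_density f))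
      ((integrable_rnDeriv_smul_iff ac₂).2 (μ₂.integrable_mul_density f))]
  refine integral_congr_ae (key.mono fun z hz => ?_)
  simp only [Pi.add_apply, Complex.real_smul] at hz ⊢
  linear_combination f z * hz

theorem IsHenkinC.mulCont {d : ℕ} {μ : CMeasure d} (hμ : IsHenkinC d μ) {φ : C(CB d, ℂ)}
    (hφ : φ ∈ ballAlg d) : IsHenkinC d (μ.mulCont φ) := by
  intro f hf ⟨C, hC⟩ hlim
  simp only [cInt_mulCont]
  refine hμ (fun n => f n * φ) (fun n => (ballAlgSub d).mul_mem (hf n) hφ)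
    ⟨C * ‖φ‖, fun n => (norm_mul_le _ _).trans (by gcongr; exact hC n)⟩ fun z hz => ?_
  simpa using (hlim z hz).mul_const (φ z)

/-- A totally singular complex measure `μ` with `φ • μ` Henkin is null off the zeros of `φ`. -/
theorem IsTotallySingularC.measure_ne_zero {d : ℕ} {μ : CMeasure d}
    (hμ : IsTotallySingularC d μ) {φ : C(CB d, ℂ)} (h : IsHenkinC d (μ.mulCont φ)) :
    μ.var {z | φ z ≠ 0} = 0 := by
  have hzero : (μ.mulCont φ).var = 0 :=
    Measure.eq_zero_of_absolutelyContinuous_of_mutuallySingular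
      (withDensity_absolutelyContinuous _ _) (hμ _ h).symm
  have hae := (withDensity_eq_zero_iff φ.continuous.measurable.enorm.aemeasurable).1 hzero
  exact measure_mono_null (fun z hz => by simpa using hz) (ae_iff.1 hae)

/-- if `μ = μ_a + μ_s` annihilates the closed ideal `J`, with `μ_a`
Henkin and `μ_s` totally singular, then `μ_s` is concentrated on `Z(J) ∩ 𝕊_d`. -/
theorem stmt16 (d : ℕ) (hd : 1 ≤ d) (J : Set C(CB d, ℂ)) (hJ : IsClosedIdeal d J)
    (μ μa μs : CMeasure d)
    (hdecomp : ∀ E : Set (CB d), MeasurableSet E →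
      ∫ z in E, μ.density z ∂μ.var =
        (∫ z in E, μa.density z ∂μa.var) + ∫ z in E, μs.density z ∂μs.var)
    (hHenkin : IsHenkinC d μa) (hTS : IsTotallySingularC d μs)
    (hann : ∀ φ ∈ J, cInt d μ φ = 0) :
    μs.var (sphereD d \ ZS d J) = 0 := by
  have hnull : ∀ φ ∈ J, μs.var {z | φ z ≠ 0} = 0 := by
    intro φ hφ
    refine hTS.measure_ne_zero fun f hf hbd hlim => ?_
    have hval : ∀ n, cInt d (μs.mulCont φ) (f n) = -cInt d (μa.mulCont φ) (f n) := fun n => by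
      have hadd := cInt_eq_add hdecomp (f n * φ)
      rw [hann _ (hJ.mul_mem _ (hf n) _ hφ)] at hadd
      rw [cInt_mulCont, cInt_mulCont]
      linear_combination -hadd
    simp only [hval]
    simpa using (hHenkin.mulCont (hJ.subset hφ) f hf hbd hlim).neg
  refine measure_null_of_locally_null _ fun z hz => ?_
  obtain ⟨φ, hφ, hne⟩ : ∃ φ ∈ J, φ z ≠ 0 := by simpa [ZS] using hz.2
  exact ⟨_, mem_nhdsWithin_of_mem_nhds
    ((isOpen_ne_fun φ.continuous continuous_const).mem_nhds hne), hnull φ hφ⟩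

end
end
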